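/- Let r ≥ 2, let F be the free group of rank r, and let C ⊆ F be the set of cyclically reduced elements. The set of full cyclically reduced elements of F is exponentially generic in C. -/

import Mathlib

namespace VG

variable {r : ℕ}

/-- Word length: the length of the unique freely reduced word representing `w`. -/
def len (w : FreeGroup (Fin r)) : ℕ := (FreeGroup.toWord w).length

/-- The number of elements of `A` of word length at most `n`. -/
noncomputable def ballCount (A : Set (FreeGroup (Fin r))) (n : ℕ) : ℕ :=
  {w | w ∈ A ∧ len w ≤ n}.ncard

/-- The number of elements of `A` of word length exactly `n`. -/
noncomputable def sphereCount (A : Set (FreeGroup (Fin r))) (n : ℕ) : ℕ :=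
  {w | w ∈ A ∧ len w = n}.ncard

/-- `A` is exponentially generic in `B`: there are `a > 0` and `b` such that, for all
sufficiently large `n`, the proportion of elements of `B` of length at most `n` lying
in `A` is at least `1 - exp (b - a n)`. -/
def ExpGeneric (A B : Set (FreeGroup (Fin r))) : Prop :=
  ∃ a : ℝ, 0 < a ∧ ∃ b : ℝ, ∃ N : ℕ, ∀ n : ℕ, N ≤ n →
    (1 : ℝ) - Real.exp (b - a * n) ≤ (ballCount A n : ℝ) / (ballCount B n)

/-- `A` is exponentially rare in `B` if its complement in `B` is exponentially generic. -/
def ExpRare (A B : Set (FreeGroup (Fin r))) : Prop := ExpGeneric (B \ A) B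

/-- `v` is a subword of `w`: the reduced word of `v` is a contiguous sublist of that of `w`. -/
def Subword (v w : FreeGroup (Fin r)) : Prop :=
  FreeGroup.toWord v <:+: FreeGroup.toWord w

/-- `w` is cyclically reduced: the first letter of its reduced word is not the inverse of
the last letter. -/
def CyclicallyReduced (w : FreeGroup (Fin r)) : Prop :=
  ∀ a ∈ (FreeGroup.toWord w).head?, ∀ b ∈ (FreeGroup.toWord w).getLast?,
    a ≠ (b.1, !b.2)

/-- `c` is the cyclic reduction of `w`: it is cyclically reduced and conjugate to `w`. -/
def IsCyclicReduction (c w : FreeGroup (Fin r)) : Prop :=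
  CyclicallyReduced c ∧ ∃ g : FreeGroup (Fin r), w = g * c * g⁻¹

/-- Middle third of a list: delete the first and last `⌈l/3⌉` entries. -/
def middleThird {α : Type*} (l : List α) : List α :=
  (l.drop ((l.length + 2) / 3)).take (l.length - 2 * ((l.length + 2) / 3))

/-- `v` is cyclically contained in `w` if the reduced word of `v` is a subword of some
positive power of the cyclic reduction of `w`. -/
def CyclicallyContains (w v : FreeGroup (Fin r)) : Prop :=
  ∃ c : FreeGroup (Fin r), IsCyclicReduction c w ∧ ∃ k : ℕ, 1 ≤ k ∧ Subword v (c ^ k)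

/-- `w` is full: every freely reduced word of length 3, or its inverse, is cyclically
contained in `w`. -/
def Full (w : FreeGroup (Fin r)) : Prop :=
  ∀ t : FreeGroup (Fin r), len t = 3 → CyclicallyContains w t ∨ CyclicallyContains w t⁻¹

/-- The group element corresponding to a single letter. -/
def letterElem (a : Fin r × Bool) : FreeGroup (Fin r) := FreeGroup.mk [a]

/-- The inverse of a letter. -/
def linv (a : Fin r × Bool) : Fin r × Bool := (a.1, !a.2)

/-- `w` is a proper power: `w = u^k` for some `k ≥ 2`. -/
def ProperPower (w : FreeGroup (Fin r)) : Prop :=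
  ∃ u : FreeGroup (Fin r), ∃ k : ℕ, 2 ≤ k ∧ w = u ^ k

/-- Minimal word length in the conjugacy class of `w`. -/
noncomputable def conjMinLen (w : FreeGroup (Fin r)) : ℕ :=
  sInf (len '' {u | IsConj u w})

/-- `w` is Whitehead minimal: for every automorphism `α` of the free group, the length of
`w` is at most the minimal length of an element conjugate to `α w`. -/
def WhiteheadMinimal (w : FreeGroup (Fin r)) : Prop :=
  ∀ α : FreeGroup (Fin r) ≃* FreeGroup (Fin r), len w ≤ conjMinLen (α w)


/-- All lists of length `m` in the letters. -/
noncomputable def allL (r m : ℕ) : Finset (List (Fin r × Bool)) :=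
  (Finset.univ : Finset (Fin m → Fin r × Bool)).image List.ofFn

lemma mem_allL {r m : ℕ} {l : List (Fin r × Bool)} : l ∈ allL r m ↔ l.length = m := by
  unfold allL
  simp only [Finset.mem_image, Finset.mem_univ, true_and]
  constructor
  · rintro ⟨f, rfl⟩; simp
  · rintro rfl; exact ⟨l.get, List.ofFn_get l⟩

lemma card_allL {r m : ℕ} : (allL r m).card = (2 * r) ^ m := by
  unfold allL
  rw [Finset.card_image_of_injective _ List.ofFn_injective]
  simp [mul_comm]

/-- Reduced extensions to the left of `l` by `k` letters. -/
noncomputable def extL {r : ℕ} (k : ℕ) (l : List (Fin r × Bool)) :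
    Finset (List (Fin r × Bool)) := by
  classical
  exact (allL r k).filter (fun p => FreeGroup.IsReduced (p ++ l))

lemma mem_extL {r k : ℕ} {l p : List (Fin r × Bool)} :
    p ∈ extL k l ↔ p.length = k ∧ FreeGroup.IsReduced (p ++ l) := by
  unfold extL; simp [mem_allL]

lemma rel_iff {r : ℕ} (a b : Fin r × Bool) : (a.1 = b.1 → a.2 = b.2) ↔ a ≠ linv b := by
  obtain ⟨a, s⟩ := a
  obtain ⟨b, t⟩ := b
  cases s <;> cases t <;> simp [linv]

lemma isReduced_cons_iff {r : ℕ} (a : Fin r × Bool) (l : List (Fin r × Bool)) (hl : l ≠ []) :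
    FreeGroup.IsReduced (a :: l) ↔ a ≠ linv (l.head hl) ∧ FreeGroup.IsReduced l := by
  cases l with
  | nil => exact absurd rfl hl
  | cons b l => rw [FreeGroup.isReduced_cons_cons, rel_iff]; rfl

lemma card_extL {r : ℕ} (k : ℕ) (l : List (Fin r × Bool)) (hl : l ≠ [])
    (hred : FreeGroup.IsReduced l) : (extL k l).card = (2 * r - 1) ^ k := by
  classical
  induction k with
  | zero =>
    have : extL 0 l = {[]} := by
      ext p
      simp only [mem_extL, Finset.mem_singleton, List.length_eq_zero_iff]
      constructor
      · exact fun h => h.1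
      · rintro rfl; exact ⟨rfl, hred⟩
    simp [this]
  | succ k ih =>
    have hmap : ∀ p ∈ extL (k + 1) l, p.tail ∈ extL k l := by
      intro p hp
      rw [mem_extL] at hp ⊢
      cases p with
      | nil => simp at hp
      | cons a p =>
        refine ⟨by simpa using hp.1, ?_⟩
        exact hp.2.infix ⟨[a], [], by simp⟩
    rw [Finset.card_eq_sum_card_fiberwise hmap, Finset.sum_congr rfl (g := fun _ => 2 * r - 1)]
    · simp [ih, pow_succ]
    · intro p hp
      rw [mem_extL] at hp
      have hne : p ++ l ≠ [] := by simp [hl]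
      have : ({x ∈ extL (k + 1) l | x.tail = p} : Finset _)
          = ((Finset.univ : Finset (Fin r × Bool)).erase (linv ((p ++ l).head hne))).image
            (fun a => a :: p) := by
        ext x
        simp only [Finset.mem_filter, mem_extL, Finset.mem_image, Finset.mem_erase,
          Finset.mem_univ, and_true]
        constructor
        · rintro ⟨⟨h1, h2⟩, rfl⟩
          cases x with
          | nil => simp at h1
          | cons a x =>
            refine ⟨a, ?_, rfl⟩
            exact ((isReduced_cons_iff a (x ++ l) hne).1 h2).1
        · rintro ⟨a, ha, rfl⟩
          refine ⟨⟨by simp [hp.1], ?_⟩, rfl⟩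
          exact (isReduced_cons_iff a (p ++ l) hne).2 ⟨ha, hp.2⟩
      rw [this, Finset.card_image_of_injective _ (fun a b h => by simpa using h),
        Finset.card_erase_of_mem (Finset.mem_univ _)]
      simp [mul_comm]

lemma exists_letter {r : ℕ} (hr : 2 ≤ r) (a b : Fin r × Bool) :
    ∃ e : Fin r × Bool, e ≠ a ∧ e ≠ b := by
  classical
  have : ({a, b} : Finset (Fin r × Bool)).card < (Finset.univ : Finset (Fin r × Bool)).card := by
    refine lt_of_le_of_lt Finset.card_le_two ?_
    simp; omega
  obtain ⟨e, -, he⟩ := Finset.exists_mem_notMem_of_card_lt_card this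
  refine ⟨e, ?_⟩
  simpa using he

lemma linv_linv {r : ℕ} (a : Fin r × Bool) : linv (linv a) = a := by simp [linv]

/-- Reduced words of length `m` avoiding `t`. -/
noncomputable def avoidL {r : ℕ} (t : List (Fin r × Bool)) (m : ℕ) :
    Finset (List (Fin r × Bool)) := by
  classical
  exact (allL r m).filter (fun p => FreeGroup.IsReduced p ∧ ¬ t <:+: p)

lemma mem_avoidL {r m : ℕ} {t p : List (Fin r × Bool)} :
    p ∈ avoidL t m ↔ p.length = m ∧ FreeGroup.IsReduced p ∧ ¬ t <:+: p := by
  unfold avoidL; simp [mem_allL]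

lemma exists_bad {r : ℕ} (hr : 2 ≤ r) (t l : List (Fin r × Bool)) (ht : t.length = 3)
    (htr : FreeGroup.IsReduced t) (hl : l ≠ []) (hred : FreeGroup.IsReduced l) :
    ∃ e, t ++ [e] ∈ extL 4 l := by
  have htn : t ≠ [] := by rintro rfl; simp at ht
  obtain ⟨e, h1, h2⟩ := exists_letter hr (linv (l.head hl)) (linv (t.getLast htn))
  refine ⟨e, ?_⟩
  rw [mem_extL]
  refine ⟨by simp [ht], ?_⟩
  rw [List.append_assoc]
  refine List.isChain_append.2 ⟨htr, (isReduced_cons_iff e l hl).2 ⟨h1, hred⟩, ?_⟩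
  intro x hx y hy
  rw [List.getLast?_eq_some_getLast htn] at hx
  simp only [Option.mem_def, Option.some.injEq] at hx
  simp at hy
  subst hx hy
  rw [rel_iff]
  intro h
  exact h2 (by rw [h, linv_linv])

lemma card_avoidL_step {r : ℕ} (hr : 2 ≤ r) (t : List (Fin r × Bool)) (ht : t.length = 3)
    (htr : FreeGroup.IsReduced t) (m : ℕ) (hm : 1 ≤ m) :
    (avoidL t (m + 4)).card ≤ ((2 * r - 1) ^ 4 - 1) * (avoidL t m).card := by
  classical
  refine Finset.card_le_mul_card_image_of_maps_to (f := List.drop 4) ?_ _ ?_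
  · intro p hp
    rw [mem_avoidL] at hp ⊢
    obtain ⟨h1, h2, h3⟩ := hp
    have hs : p.drop 4 <:+: p := (List.drop_suffix 4 p).isInfix
    exact ⟨by simp [h1], h2.infix hs, fun h => h3 (h.trans hs)⟩
  · intro l hl
    rw [mem_avoidL] at hl
    have hne : l ≠ [] := by rintro rfl; simp at hl; omega
    obtain ⟨e, he⟩ := exists_bad hr t l ht htr hne hl.2.1
    rw [← card_extL 4 l hne hl.2.1, ← Finset.card_erase_of_mem he]
    refine Finset.card_le_card_of_injOn (List.take 4) ?_ ?_
    · intro p hp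
      simp only [Finset.coe_filter, Set.mem_ofPred_eq, mem_avoidL] at hp
      obtain ⟨⟨h1, h2, h3⟩, h4⟩ := hp
      have h5 : p.take 4 ++ l = p := by rw [← h4]; exact List.take_append_drop 4 p
      rw [Finset.mem_coe, Finset.mem_erase, mem_extL, h5]
      refine ⟨?_, by simp [h1], h2⟩
      intro h6
      apply h3
      rw [← h5, h6]
      exact ⟨[], [e] ++ l, by simp⟩
    · intro p hp p' hp' h
      simp only [Finset.coe_filter, Set.mem_ofPred_eq] at hp hp'
      rw [← List.take_append_drop 4 p, ← List.take_append_drop 4 p', hp.2, hp'.2, h]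

lemma card_avoidL_le {r : ℕ} (hr : 2 ≤ r) (t : List (Fin r × Bool)) (ht : t.length = 3)
    (htr : FreeGroup.IsReduced t) (ρ : ℝ) (hρ : 1 < ρ)
    (hρ4 : ρ ^ 4 = ((2 * r - 1 : ℕ) : ℝ) ^ 4 - 1) (m : ℕ) :
    ((avoidL t m).card : ℝ) ≤ (2 * r : ℝ) ^ 4 * ρ ^ m := by
  induction m using Nat.strong_induction_on with
  | _ m ih =>
    rcases Nat.lt_or_ge m 5 with h | h
    · have h1 : (avoidL t m).card ≤ (2 * r) ^ m := by
        rw [← card_allL]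
        refine Finset.card_le_card ?_
        intro p hp
        rw [mem_avoidL] at hp
        exact mem_allL.2 hp.1
      have h2 : (2 * r) ^ m ≤ (2 * r) ^ 4 := Nat.pow_le_pow_right (by omega) (by omega)
      have h3 : ((avoidL t m).card : ℝ) ≤ (2 * r : ℝ) ^ 4 := by exact_mod_cast h1.trans h2
      have h4 : 1 ≤ ρ ^ m := one_le_pow₀ hρ.le
      nlinarith [show (0:ℝ) ≤ (2 * r : ℝ) ^ 4 by positivity]
    · obtain ⟨k, rfl⟩ : ∃ k, m = k + 4 := ⟨m - 4, by omega⟩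
      have h1 := card_avoidL_step hr t ht htr k (by omega)
      have h2 : ((((2 * r - 1) ^ 4 - 1 : ℕ)) : ℝ) = ρ ^ 4 := by
        rw [hρ4, Nat.cast_sub (Nat.one_le_pow _ _ (by omega))]
        push_cast
        rfl
      have h3 : ((avoidL t (k + 4)).card : ℝ) ≤ ρ ^ 4 * (avoidL t k).card := by
        rw [← h2]; exact_mod_cast h1
      have h4 := ih k (by omega)
      calc _ ≤ ρ ^ 4 * (avoidL t k).card := h3
        _ ≤ ρ ^ 4 * ((2 * r : ℝ) ^ 4 * ρ ^ k) := by gcongr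
        _ = _ := by ring

lemma finite_ball {r : ℕ} (A : Set (FreeGroup (Fin r))) (n : ℕ) :
    {w | w ∈ A ∧ len w ≤ n}.Finite := by
  classical
  refine Set.Finite.of_finite_image (f := FreeGroup.toWord) ?_
    FreeGroup.toWord_injective.injOn
  refine Set.Finite.subset ((Finset.range (n + 1)).biUnion (allL r)).finite_toSet ?_
  rintro _ ⟨w, hw, rfl⟩
  simp only [Finset.coe_biUnion, Set.mem_iUnion, Finset.mem_coe, Finset.mem_range, mem_allL]
  exact ⟨_, Nat.lt_succ_of_le hw.2, rfl⟩

lemma ballCount_lower {r : ℕ} (hr : 2 ≤ r) (n : ℕ) :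
    (2 * r - 1) ^ n ≤ ballCount {w : FreeGroup (Fin r) | CyclicallyReduced w} (n + 2) := by
  classical
  let a : Fin r × Bool := (⟨0, by omega⟩, true)
  rw [← card_extL n [a] (by simp) FreeGroup.IsReduced.singleton, ← Set.ncard_coe_finset]
  have hne : ∀ p : List (Fin r × Bool), p ++ [a] ≠ [] := by simp
  choose f hf1 hf2 using fun p : List (Fin r × Bool) =>
    exists_letter hr (linv ((p ++ [a]).head (hne p))) (linv a)
  have key : ∀ p ∈ extL n [a],
      (FreeGroup.mk (f p :: (p ++ [a]))).toWord = f p :: (p ++ [a]) := by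
    intro p hp
    rw [mem_extL] at hp
    rw [FreeGroup.toWord_mk]
    exact ((isReduced_cons_iff _ _ (hne p)).2 ⟨hf1 p, hp.2⟩).reduce_eq
  refine Set.ncard_le_ncard_of_injOn (fun p => FreeGroup.mk (f p :: (p ++ [a]))) ?_ ?_
    (finite_ball _ _)
  · intro p hp
    have hk := key p hp
    rw [Finset.mem_coe, mem_extL] at hp
    refine ⟨?_, ?_⟩
    · show CyclicallyReduced _
      unfold CyclicallyReduced
      rw [hk]
      intro x hx y hy
      rw [← List.cons_append, List.getLast?_concat] at hy
      simp only [List.head?_cons, Option.mem_def, Option.some.injEq] at hx hy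
      subst hx hy
      exact hf2 p
    · unfold len
      rw [hk]
      simp [hp.1]
  · intro p hp p' hp' h
    have h' := congrArg FreeGroup.toWord h
    simp only [] at h'
    rw [key p hp, key p' hp'] at h'
    simpa using (List.cons.inj h').2

lemma not_full {r : ℕ} {w : FreeGroup (Fin r)} (hw : CyclicallyReduced w) (hf : ¬ Full w) :
    ∃ t : List (Fin r × Bool), t.length = 3 ∧ FreeGroup.IsReduced t ∧ ¬ t <:+: w.toWord := by
  unfold Full at hf
  push Not at hf
  obtain ⟨t, ht, h, -⟩ := hf
  refine ⟨t.toWord, ht, FreeGroup.isReduced_toWord, fun h' => h ?_⟩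
  exact ⟨w, ⟨hw, 1, by simp⟩, 1, le_rfl, by simpa [Subword] using h'⟩

lemma ballCount_upper {r : ℕ} (hr : 2 ≤ r) (ρ : ℝ) (hρ : 1 < ρ)
    (hρ4 : ρ ^ 4 = ((2 * r - 1 : ℕ) : ℝ) ^ 4 - 1) (n : ℕ) :
    (ballCount {w : FreeGroup (Fin r) | CyclicallyReduced w ∧ ¬ Full w} n : ℝ) ≤
      (2 * r : ℝ) ^ 3 * ((2 * r : ℝ) ^ 4 * (ρ ^ (n + 1) / (ρ - 1))) := by
  classical
  let T := (allL r 3).filter FreeGroup.IsReduced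
  let S := T.biUnion (fun t => (Finset.range (n + 1)).biUnion (avoidL t))
  have h1 : ballCount {w : FreeGroup (Fin r) | CyclicallyReduced w ∧ ¬ Full w} n ≤ S.card := by
    unfold ballCount
    rw [← Set.ncard_coe_finset]
    refine Set.ncard_le_ncard_of_injOn FreeGroup.toWord ?_ FreeGroup.toWord_injective.injOn
      S.finite_toSet
    rintro w ⟨⟨hw, hf⟩, hn⟩
    obtain ⟨t, ht, htr, htw⟩ := not_full hw hf
    simp only [S, T, Finset.mem_coe, Finset.mem_biUnion, Finset.mem_filter, Finset.mem_range,
      mem_allL, mem_avoidL]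
    exact ⟨t, ⟨ht, htr⟩, _, Nat.lt_succ_of_le hn, rfl, FreeGroup.isReduced_toWord, htw⟩
  have h2 : S.card ≤ ∑ t ∈ T, ∑ m ∈ Finset.range (n + 1), (avoidL t m).card :=
    Finset.card_biUnion_le.trans (Finset.sum_le_sum fun t _ => Finset.card_biUnion_le)
  have hK : (0 : ℝ) ≤ (2 * r : ℝ) ^ 4 * (ρ ^ (n + 1) / (ρ - 1)) := by
    have : 0 < ρ - 1 := by linarith
    positivity
  have hT : (T.card : ℝ) ≤ (2 * r : ℝ) ^ 3 := by
    have : T.card ≤ (2 * r) ^ 3 := by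
      rw [← card_allL]; exact Finset.card_filter_le _ _
    exact_mod_cast this
  calc (ballCount {w : FreeGroup (Fin r) | CyclicallyReduced w ∧ ¬ Full w} n : ℝ)
      ≤ ∑ t ∈ T, ∑ m ∈ Finset.range (n + 1), ((avoidL t m).card : ℝ) := by
        exact_mod_cast h1.trans h2
    _ ≤ ∑ t ∈ T, (2 * r : ℝ) ^ 4 * (ρ ^ (n + 1) / (ρ - 1)) := by
        refine Finset.sum_le_sum fun t ht => ?_
        simp only [T, Finset.mem_filter, mem_allL] at ht
        calc _ ≤ ∑ m ∈ Finset.range (n + 1), (2 * r : ℝ) ^ 4 * ρ ^ m :=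
              Finset.sum_le_sum fun m _ => card_avoidL_le hr t ht.1 ht.2 ρ hρ hρ4 m
          _ = (2 * r : ℝ) ^ 4 * ((ρ ^ (n + 1) - 1) / (ρ - 1)) := by
              rw [← Finset.mul_sum, geom_sum_eq hρ.ne']
          _ ≤ _ := by
              have : 0 < ρ - 1 := by linarith
              gcongr
              linarith
    _ = (T.card : ℝ) * ((2 * r : ℝ) ^ 4 * (ρ ^ (n + 1) / (ρ - 1))) := by
        rw [Finset.sum_const, nsmul_eq_mul]
    _ ≤ _ := by gcongr

lemma ballCount_add {r : ℕ} (n : ℕ) :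
    ballCount {w : FreeGroup (Fin r) | CyclicallyReduced w} n =
      ballCount {w : FreeGroup (Fin r) | CyclicallyReduced w ∧ Full w} n +
      ballCount {w : FreeGroup (Fin r) | CyclicallyReduced w ∧ ¬ Full w} n := by
  unfold ballCount
  rw [← Set.ncard_union_eq ?_ (finite_ball _ _) (finite_ball _ _)]
  · congr 1
    ext w
    simp only [Set.mem_ofPred_eq, Set.mem_union]
    tauto
  · rw [Set.disjoint_left]
    rintro w ⟨⟨_, hfull⟩, _⟩ ⟨⟨_, hnot⟩, _⟩
    exact hnot hfull

/-- the set of full, cyclically reduced elements is exponentially generic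
in the set `C` of cyclically reduced elements. -/
theorem full_expGeneric_cyclicallyReduced {r : ℕ} (hr : 2 ≤ r) :
    ExpGeneric {w : FreeGroup (Fin r) | CyclicallyReduced w ∧ Full w}
      {w : FreeGroup (Fin r) | CyclicallyReduced w} := by
  set q : ℝ := ((2 * r - 1 : ℕ) : ℝ) with hq
  have hq3 : (3 : ℝ) ≤ q := by
    have : 3 ≤ 2 * r - 1 := by omega
    rw [hq]; exact_mod_cast this
  have hq4 : (81 : ℝ) ≤ q ^ 4 := by
    calc (81 : ℝ) = 3 ^ 4 := by norm_num
      _ ≤ q ^ 4 := by gcongr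
  obtain ⟨ρ, hρ0, hρ4⟩ : ∃ ρ : ℝ, 0 ≤ ρ ∧ ρ ^ 4 = q ^ 4 - 1 := by
    refine ⟨(q ^ 4 - 1) ^ ((1 : ℝ) / 4), Real.rpow_nonneg (by linarith) _, ?_⟩
    rw [← Real.rpow_natCast, ← Real.rpow_mul (by linarith)]
    norm_num
  have hρ1 : 1 < ρ := by
    by_contra h
    have : ρ ^ 4 ≤ 1 := pow_le_one₀ hρ0 (not_lt.1 h)
    linarith
  have hρq : ρ < q := lt_of_pow_lt_pow_left₀ 4 (by linarith) (by linarith)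
  have hqpos : 0 < q := by linarith
  have hρpos : 0 < ρ := by linarith
  have hρ1' : 0 < ρ - 1 := by linarith
  have hrpos : (0 : ℝ) < r := by exact_mod_cast (by omega : 0 < r)
  set K : ℝ := (2 * r : ℝ) ^ 3 * ((2 * r : ℝ) ^ 4 * (ρ / (ρ - 1))) * q ^ 2 with hK
  have hKpos : 0 < K := by positivity
  refine ⟨Real.log (q / ρ), Real.log_pos ((one_lt_div hρpos).2 hρq), Real.log K, 2, ?_⟩
  intro n hn
  obtain ⟨k, rfl⟩ : ∃ k, n = k + 2 := ⟨n - 2, by omega⟩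
  have hexp : Real.exp (Real.log K - Real.log (q / ρ) * ((k + 2 : ℕ) : ℝ))
      = K * ρ ^ (k + 2) / q ^ (k + 2) := by
    rw [Real.exp_sub, Real.exp_log hKpos, mul_comm, Real.exp_nat_mul,
      Real.exp_log (by positivity), div_pow]
    field_simp
  have hlow : q ^ k ≤ (ballCount {w : FreeGroup (Fin r) | CyclicallyReduced w} (k + 2) : ℝ) := by
    rw [hq]; exact_mod_cast ballCount_lower hr k
  have hup := ballCount_upper hr ρ hρ1 hρ4 (k + 2)
  have hadd : (ballCount {w : FreeGroup (Fin r) | CyclicallyReduced w} (k + 2) : ℝ) = _ :=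
    congrArg (Nat.cast (R := ℝ)) (ballCount_add (k + 2))
  push_cast at hadd
  have hpos : 0 < (ballCount {w : FreeGroup (Fin r) | CyclicallyReduced w} (k + 2) : ℝ) :=
    lt_of_lt_of_le (by positivity) hlow
  rw [hexp, le_div_iff₀ hpos]
  have h1 : K * ρ ^ (k + 2) / q ^ (k + 2) * q ^ k =
      (2 * r : ℝ) ^ 3 * ((2 * r : ℝ) ^ 4 * (ρ ^ (k + 2 + 1) / (ρ - 1))) := by
    rw [hK]
    field_simp
    ring
  have h2 : K * ρ ^ (k + 2) / q ^ (k + 2) * q ^ k ≤ K * ρ ^ (k + 2) / q ^ (k + 2) *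
      (ballCount {w : FreeGroup (Fin r) | CyclicallyReduced w} (k + 2) : ℝ) := by
    gcongr
  linarith

end VG
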